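/- Let d ≥ 1, α > 0, α ≠ 1, and S(t) = e^{−it|D_x|^α}. Let s, σ ∈ ℝ and suppose there exist t₀ ≠ 0 and C > 0 such that ‖S(t₀)u‖_{C^s_*(ℝ^d)} ≤ C‖u‖_{C^σ_*(ℝ^d)} for all u ∈ C^σ_*(ℝ^d). Then s ≤ σ − dα/2. -/

import Mathlib

open MeasureTheory Real Set
open scoped FourierTransform ENNReal

noncomputable section

/-- Convolution of `u` with the inverse Fourier transform of the (real) symbol `ψ`;
for `ψ ∈ C_0^∞` this is the frequency-localization operator `ψ(D)u`. -/
def symbolOp (d : ℕ) (ψ : EuclideanSpace ℝ (Fin d) → ℝ)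
    (u : EuclideanSpace ℝ (Fin d) → ℂ) : EuclideanSpace ℝ (Fin d) → ℂ :=
  fun x => ∫ y, 𝓕⁻ (fun ξ : EuclideanSpace ℝ (Fin d) => ((ψ ξ : ℝ) : ℂ)) y * u (x - y)

/-- The dyadic dilate `ξ ↦ φ(2^{-j} ξ)` of an annulus cutoff. -/
def dyadic (d : ℕ) (φ : EuclideanSpace ℝ (Fin d) → ℝ) (j : ℕ) :
    EuclideanSpace ℝ (Fin d) → ℝ :=
  fun ξ => φ (((2 : ℝ) ^ j)⁻¹ • ξ)

/-- The Zygmund norm `‖u‖_{C^σ_*} = max( ‖χ_low(D)u‖_{L^∞}, sup_j 2^{jσ} ‖Δ_j u‖_{L^∞} )`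
associated with a Littlewood–Paley decomposition `(χl, φ)`. -/
def zygNorm (d : ℕ) (χl φ : EuclideanSpace ℝ (Fin d) → ℝ) (σ : ℝ)
    (u : EuclideanSpace ℝ (Fin d) → ℂ) : ℝ≥0∞ :=
  (⨆ x, (‖symbolOp d χl u x‖₊ : ℝ≥0∞)) ⊔
    ⨆ j : ℕ, ENNReal.ofReal ((2 : ℝ) ^ ((j : ℝ) * σ)) *
      ⨆ x, (‖symbolOp d (dyadic d φ j) u x‖₊ : ℝ≥0∞)

section Dispersion

variable {E : Type*} [NormedAddCommGroup E] [InnerProductSpace ℝ E]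

theorem norm_iteratedFDeriv_comp_add_smul_le {F : Type*} [NormedAddCommGroup F] [NormedSpace ℝ F]
    {f : E → F} (hf : ContDiff ℝ (⊤ : ℕ∞) f) (n : ℕ) (x : E) (μ : ℝ) (η : E) :
    ‖iteratedFDeriv ℝ n (fun y => f (x + μ • y)) η‖ ≤
      |μ| ^ n * ‖iteratedFDeriv ℝ n f (x + μ • η)‖ := by
  have h1 : ContDiff ℝ n (fun y => f (x + y)) :=
    (hf.of_le (by exact_mod_cast le_top)).comp (contDiff_const.add contDiff_id)
  have h2 := congrFun (iteratedFDeriv_comp_const_smul μ h1) η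
  rw [h2]
  simp only [norm_smul, norm_pow, Real.norm_eq_abs, iteratedFDeriv_comp_add_left]
  exact le_rfl

theorem exists_norm_iteratedFDeriv_le {F : Type*} [NormedAddCommGroup F] [NormedSpace ℝ F]
    {f : E → F} (hf : ContDiff ℝ (⊤ : ℕ∞) f) (hc : HasCompactSupport f) (N : ℕ) :
    ∃ B : ℝ, 1 ≤ B ∧ ∀ n ≤ N, ∀ x, ‖iteratedFDeriv ℝ n f x‖ ≤ B := by
  have h : ∀ n : ℕ, ∃ B : ℝ, ∀ x, ‖iteratedFDeriv ℝ n f x‖ ≤ B := fun n =>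
    (hc.iteratedFDeriv n).exists_bound_of_continuous
      (hf.continuous_iteratedFDeriv (by exact_mod_cast le_top))
  choose B hB using h
  refine ⟨1 + ∑ n ∈ Finset.range (N + 1), |B n|, ?_, fun n hn x => ?_⟩
  · linarith [Finset.sum_nonneg (fun n (_ : n ∈ Finset.range (N + 1)) => abs_nonneg (B n))]
  · have := Finset.single_le_sum (f := fun n => |B n|) (fun n _ => abs_nonneg (B n))
      (Finset.mem_range.2 (Nat.lt_succ_of_le hn))
    linarith [hB n x, le_abs_self (B n)]

/-- The second-order Taylor remainder of `ψ` at `x`, zoomed in at scale `μ`. -/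
def zoomedRemainder (ψ : E → ℝ) (μ : ℝ) (x η : E) : ℝ :=
  (μ ^ 2)⁻¹ * (ψ (x + μ • η) - ψ x - μ * fderiv ℝ ψ x η)

theorem contDiff_zoomedRemainder {ψ : E → ℝ} (hψ : ContDiff ℝ (⊤ : ℕ∞) ψ) (μ : ℝ) (x : E) :
    ContDiff ℝ (⊤ : ℕ∞) (zoomedRemainder ψ μ x) := by
  unfold zoomedRemainder
  have : ContDiff ℝ (⊤ : ℕ∞) (fun η => ψ (x + μ • η)) :=
    hψ.comp (contDiff_const.add (contDiff_const.smul contDiff_id))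
  have h2 : ContDiff ℝ (⊤ : ℕ∞) (fun η => fderiv ℝ ψ x η) := (fderiv ℝ ψ x).contDiff
  fun_prop

theorem fderiv_zoomedRemainder {ψ : E → ℝ} (hψ : ContDiff ℝ (⊤ : ℕ∞) ψ) {μ : ℝ} (hμ : 0 < μ)
    (x : E) : fderiv ℝ (zoomedRemainder ψ μ x) =
      fun η => μ⁻¹ • (fderiv ℝ ψ (x + μ • η) - fderiv ℝ ψ x) := by
  funext η
  apply HasFDerivAt.fderiv
  have h0 : HasFDerivAt (fun η : E => x + μ • η) (μ • ContinuousLinearMap.id ℝ E) η :=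
    ((hasFDerivAt_id η).const_smul μ).const_add x
  have h1 : HasFDerivAt (fun η => ψ (x + μ • η))
      ((fderiv ℝ ψ (x + μ • η)).comp (μ • ContinuousLinearMap.id ℝ E)) η :=
    HasFDerivAt.comp (f := fun η : E => x + μ • η) η
      (hψ.differentiable (by simp) (x + μ • η)).hasFDerivAt h0
  have h2 := (((h1.sub_const (ψ x)).sub
    ((fderiv ℝ ψ x).hasFDerivAt.const_mul μ)).const_mul ((μ ^ 2)⁻¹))
  refine h2.congr_fderiv ?_
  ext v
  simp
  field_simp

theorem exists_norm_iteratedFDeriv_zoomedRemainder_le {ψ : E → ℝ}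
    (hψ : ContDiff ℝ (⊤ : ℕ∞) ψ) (hc : HasCompactSupport ψ) (N : ℕ) (r : ℝ) :
    ∃ D : ℝ, 1 ≤ D ∧ ∀ μ, 0 < μ → μ ≤ 1 → ∀ x η, ‖η‖ ≤ r → ∀ n, 1 ≤ n → n ≤ N →
      ‖iteratedFDeriv ℝ n (zoomedRemainder ψ μ x) η‖ ≤ D := by
  obtain ⟨B, hB1, hB⟩ := exists_norm_iteratedFDeriv_le hψ hc (N + 2)
  have hd : ContDiff ℝ (⊤ : ℕ∞) (fderiv ℝ ψ) := hψ.fderiv_right (by simp)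
  refine ⟨B * (1 + |r|), by nlinarith [abs_nonneg r], fun μ hμ hμ1 x η hη n hn1 hnN => ?_⟩
  obtain ⟨m, rfl⟩ : ∃ m, n = m + 1 := ⟨n - 1, by omega⟩
  rw [← norm_iteratedFDeriv_fderiv, fderiv_zoomedRemainder hψ hμ]
  have hr : B ≤ B * (1 + |r|) := by nlinarith [abs_nonneg r]
  rcases Nat.eq_zero_or_pos m with rfl | hm
  · rw [norm_iteratedFDeriv_zero, norm_smul, norm_inv, Real.norm_of_nonneg hμ.le]
    have hmv : ‖fderiv ℝ ψ (x + μ • η) - fderiv ℝ ψ x‖ ≤ B * ‖x + μ • η - x‖ := by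
      refine Convex.norm_image_sub_le_of_norm_fderiv_le (𝕜 := ℝ) (s := univ)
        (fun z _ => hd.differentiable (by simp) z) (fun z _ => ?_) convex_univ trivial trivial
      have := hB 2 (by omega) z
      rwa [← norm_iteratedFDeriv_one, norm_iteratedFDeriv_fderiv]
    rw [add_sub_cancel_left, norm_smul, Real.norm_of_nonneg hμ.le] at hmv
    calc μ⁻¹ * ‖fderiv ℝ ψ (x + μ • η) - fderiv ℝ ψ x‖ ≤ μ⁻¹ * (B * (μ * ‖η‖)) := by gcongr
      _ = B * ‖η‖ := by field_simp
      _ ≤ B * (1 + |r|) := by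
        gcongr
        linarith [le_abs_self r]
  · have hd' : ContDiff ℝ m (fderiv ℝ ψ) := hd.of_le (by exact_mod_cast le_top)
    have hcomp : ContDiff ℝ m (fun η => fderiv ℝ ψ (x + μ • η)) :=
      hd'.comp (contDiff_const.add (contDiff_const.smul contDiff_id))
    rw [iteratedFDeriv_const_smul_apply' (hcomp.sub contDiff_const).contDiffAt,
      fun_iteratedFDeriv_sub_apply hcomp.contDiffAt contDiff_const.contDiffAt,
      iteratedFDeriv_const_of_ne hm.ne']
    simp only [Pi.zero_apply, sub_zero]
    rw [norm_smul, norm_inv, Real.norm_of_nonneg hμ.le]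
    have h1 := norm_iteratedFDeriv_comp_add_smul_le hd m x μ η
    rw [norm_iteratedFDeriv_fderiv, abs_of_pos hμ] at h1
    have h2 := hB (m + 1) (by omega) (x + μ • η)
    have h3 : μ ^ m ≤ μ := by simpa using pow_le_pow_of_le_one hμ.le hμ1 hm
    calc _ ≤ μ⁻¹ * (μ * B) := by
          gcongr
          refine h1.trans ?_
          gcongr
      _ = B := by field_simp
      _ ≤ _ := hr

/-- The amplitude of the wave packet of width `μ` centred at frequency `x`. -/
def packet (ψ : E → ℝ) (a χ : E → ℂ) (μ : ℝ) (x η : E) : ℂ :=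
  Complex.exp (Complex.I * (zoomedRemainder ψ μ x η : ℂ)) * (a (x + μ • η) * χ η)

theorem norm_iteratedFDeriv_cexp_I_mul (n : ℕ) (r : ℝ) :
    ‖iteratedFDeriv ℝ n (fun s : ℝ => Complex.exp (Complex.I * (s : ℂ))) r‖ = 1 := by
  rw [norm_iteratedFDeriv_eq_norm_iteratedDeriv]
  have h : ∀ n : ℕ, iteratedDeriv n (fun s : ℝ => Complex.exp (Complex.I * (s : ℂ))) =
      fun s : ℝ => Complex.I ^ n * Complex.exp (Complex.I * (s : ℂ)) := by
    intro n
    induction n with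
    | zero => simp
    | succ n ih =>
      rw [iteratedDeriv_succ, ih]
      funext s
      have h1 : HasDerivAt (fun s : ℝ => Complex.I * (s : ℂ)) (Complex.I * 1) s :=
        (Complex.ofRealCLM.hasDerivAt (x := s)).const_mul Complex.I
      rw [(h1.cexp.const_mul (Complex.I ^ n)).deriv]
      ring
  rw [h, norm_mul, norm_pow, mul_comm Complex.I, Complex.norm_exp_ofReal_mul_I]
  simp

theorem contDiff_cexp_I_mul : ContDiff ℝ (⊤ : ℕ∞) (fun s : ℝ => Complex.exp (Complex.I * (s : ℂ))) :=
  (contDiff_const.mul Complex.ofRealCLM.contDiff).cexp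

theorem contDiff_packet {ψ : E → ℝ} {a χ : E → ℂ} (hψ : ContDiff ℝ (⊤ : ℕ∞) ψ)
    (ha : ContDiff ℝ (⊤ : ℕ∞) a) (hχ : ContDiff ℝ (⊤ : ℕ∞) χ) (μ : ℝ) (x : E) :
    ContDiff ℝ (⊤ : ℕ∞) (packet ψ a χ μ x) :=
  (contDiff_cexp_I_mul.comp (contDiff_zoomedRemainder hψ μ x)).mul
    ((ha.comp (contDiff_const.add (contDiff_const.smul contDiff_id))).mul hχ)

theorem norm_iteratedFDeriv_mul_le_of_le {f g : E → ℂ} (hf : ContDiff ℝ (⊤ : ℕ∞) f)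
    (hg : ContDiff ℝ (⊤ : ℕ∞) g) {A B : ℝ} {N : ℕ} (x : E) (hA0 : 0 ≤ A)
    (hA : ∀ n ≤ N, ‖iteratedFDeriv ℝ n f x‖ ≤ A) (hB : ∀ n ≤ N, ‖iteratedFDeriv ℝ n g x‖ ≤ B)
    {n : ℕ} (hn : n ≤ N) :
    ‖iteratedFDeriv ℝ n (fun y => f y * g y) x‖ ≤ 2 ^ N * (A * B) := by
  have hB0 : 0 ≤ B := (norm_nonneg _).trans (hB 0 (Nat.zero_le _))
  refine (norm_iteratedFDeriv_mul_le hf hg x (n := n) (by exact_mod_cast le_top)).trans ?_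
  calc _ ≤ ∑ i ∈ Finset.range (n + 1), (n.choose i : ℝ) * (A * B) := by
        refine Finset.sum_le_sum fun i hi => ?_
        have hi' : i ≤ n := Nat.lt_succ_iff.1 (Finset.mem_range.1 hi)
        rw [mul_assoc]
        gcongr
        · exact hA i (hi'.trans hn)
        · exact hB (n - i) ((Nat.sub_le _ _).trans hn)
    _ = 2 ^ n * (A * B) := by
        rw [← Finset.sum_mul]
        congr 1
        exact_mod_cast Nat.sum_range_choose n
    _ ≤ 2 ^ N * (A * B) := by
        gcongr
        norm_num

theorem exists_norm_iteratedFDeriv_packet_le {ψ : E → ℝ} {a χ : E → ℂ}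
    (hψ : ContDiff ℝ (⊤ : ℕ∞) ψ) (hψc : HasCompactSupport ψ)
    (ha : ContDiff ℝ (⊤ : ℕ∞) a) (hac : HasCompactSupport a)
    (hχ : ContDiff ℝ (⊤ : ℕ∞) χ) (hχc : HasCompactSupport χ) (N : ℕ) (r : ℝ) :
    ∃ C : ℝ, 0 ≤ C ∧ ∀ μ, 0 < μ → μ ≤ 1 → ∀ x η, ‖η‖ ≤ r → ∀ n ≤ N,
      ‖iteratedFDeriv ℝ n (packet ψ a χ μ x) η‖ ≤ C := by
  obtain ⟨D, hD1, hD⟩ := exists_norm_iteratedFDeriv_zoomedRemainder_le hψ hψc N r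
  obtain ⟨A, hA1, hA⟩ := exists_norm_iteratedFDeriv_le ha hac N
  obtain ⟨B, hB1, hB⟩ := exists_norm_iteratedFDeriv_le hχ hχc N
  refine ⟨2 ^ N * ((N.factorial * 1 * D ^ N) * (2 ^ N * (A * B))), by positivity,
    fun μ hμ hμ1 x η hη n hn => ?_⟩
  have hax : ContDiff ℝ (⊤ : ℕ∞) (fun y => a (x + μ • y)) :=
    ha.comp (contDiff_const.add (contDiff_const.smul contDiff_id))
  refine norm_iteratedFDeriv_mul_le_of_le
    (contDiff_cexp_I_mul.comp (contDiff_zoomedRemainder hψ μ x)) (hax.mul hχ) η (by positivity)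
    (fun m hm => ?_) (fun m hm => ?_) hn
  · refine (norm_iteratedFDeriv_comp_le contDiff_cexp_I_mul (contDiff_zoomedRemainder hψ μ x)
      (n := m) (by exact_mod_cast le_top) η (C := 1) (D := D)
      (fun i _ => (norm_iteratedFDeriv_cexp_I_mul i _).le) (fun i hi him => ?_)).trans ?_
    · exact (hD μ hμ hμ1 x η hη i hi (him.trans hm)).trans (le_self_pow₀ hD1 (by omega))
    · gcongr
  · refine norm_iteratedFDeriv_mul_le_of_le hax hχ η (by positivity) (fun k hk => ?_)
      (fun k hk => hB k hk η) hm
    refine (norm_iteratedFDeriv_comp_add_smul_le ha k x μ η).trans ?_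
    rw [abs_of_pos hμ]
    calc _ ≤ 1 * A := by
          gcongr
          · exact pow_le_one₀ hμ.le hμ1
          · exact hA k hk _
      _ = A := one_mul A

theorem packet_eq_zero {ψ : E → ℝ} {a χ : E → ℂ} {μ : ℝ} {x η : E} (h : χ η = 0) :
    packet ψ a χ μ x η = 0 := by
  simp [packet, h]

theorem iteratedFDeriv_packet_eq_zero {ψ : E → ℝ} {a χ : E → ℂ} {r : ℝ}
    (hχr : ∀ η, χ η ≠ 0 → ‖η‖ ≤ r) {μ : ℝ} {x η : E} (n : ℕ) (hη : r < ‖η‖) :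
    iteratedFDeriv ℝ n (packet ψ a χ μ x) η = 0 := by
  have hsub : tsupport (packet ψ a χ μ x) ⊆ Metric.closedBall 0 r := by
    refine closure_minimal (fun y hy => ?_) Metric.isClosed_closedBall
    rw [mem_closedBall_zero_iff]
    exact hχr y fun h => hy (packet_eq_zero h)
  by_contra h
  have := hsub (support_iteratedFDeriv_subset n h)
  rw [mem_closedBall_zero_iff] at this
  linarith

variable [FiniteDimensional ℝ E]

theorem hasCompactSupport_packet {ψ : E → ℝ} {a χ : E → ℂ} {r : ℝ}
    (hχr : ∀ η, χ η ≠ 0 → ‖η‖ ≤ r) (μ : ℝ) (x : E) :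
    HasCompactSupport (packet ψ a χ μ x) := by
  refine HasCompactSupport.intro (isCompact_closedBall (0 : E) r) fun η hη => ?_
  refine packet_eq_zero (by_contra fun h => hη ?_)
  rw [mem_closedBall_zero_iff]
  exact hχr η h

variable [MeasurableSpace E] [BorelSpace E]

/-- Wave packets have rapidly decaying Fourier transforms, uniformly in the width and centre. -/
theorem exists_norm_fourierInv_packet_le {ψ : E → ℝ} {a χ : E → ℂ}
    (hψ : ContDiff ℝ (⊤ : ℕ∞) ψ) (hψc : HasCompactSupport ψ)
    (ha : ContDiff ℝ (⊤ : ℕ∞) a) (hac : HasCompactSupport a)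
    (hχ : ContDiff ℝ (⊤ : ℕ∞) χ) {r : ℝ}
    (hχr : ∀ η, χ η ≠ 0 → ‖η‖ ≤ r) (N : ℕ) :
    ∃ C : ℝ, 0 ≤ C ∧ ∀ μ, 0 < μ → μ ≤ 1 → ∀ x w,
      (1 + ‖w‖) ^ N * ‖𝓕⁻ (packet ψ a χ μ x) w‖ ≤ C := by
  have hχc : HasCompactSupport χ := by
    refine HasCompactSupport.intro (isCompact_closedBall (0 : E) r) fun η hη => ?_
    refine by_contra fun h => hη ?_
    rw [mem_closedBall_zero_iff]
    exact hχr η h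
  obtain ⟨B, hB0, hB⟩ := exists_norm_iteratedFDeriv_packet_le hψ hψc ha hac hχ hχc N r
  set V : ℝ := (volume : Measure E).real (Metric.closedBall (0 : E) r) with hV
  have hV0 : 0 ≤ V := measureReal_nonneg
  have hint : ∀ μ, 0 < μ → μ ≤ 1 → ∀ x, ∀ n ≤ N,
      ∫ v, ‖iteratedFDeriv ℝ n (packet ψ a χ μ x) v‖ ≤ B * V := by
    intro μ hμ hμ1 x n hn
    rw [← setIntegral_eq_integral_of_forall_compl_eq_zero (s := Metric.closedBall (0 : E) r)]
    · refine (Real.le_norm_self _).trans (norm_setIntegral_le_of_norm_le_const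
        measure_closedBall_lt_top fun η hη => ?_)
      rw [norm_norm]
      exact hB μ hμ hμ1 x η (mem_closedBall_zero_iff.1 hη) n hn
    · intro η hη
      rw [mem_closedBall_zero_iff, not_le] at hη
      rw [iteratedFDeriv_packet_eq_zero hχr n hη, norm_zero]
  have hpow : ∀ μ, 0 < μ → μ ≤ 1 → ∀ x w, ∀ n ≤ N,
      ‖w‖ ^ n * ‖𝓕⁻ (packet ψ a χ μ x) w‖ ≤ 2 ^ N * ((N + 1) * (B * V)) := by
    intro μ hμ hμ1 x w n hn
    have hsm := contDiff_packet hψ ha hχ μ x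
    have hcs : HasCompactSupport (packet ψ a χ μ x) := hasCompactSupport_packet hχr μ x
    have h := Real.pow_mul_norm_iteratedFDeriv_fourier_le (K := ⊤) (N := ⊤) hsm
      (fun k m _ _ => by
        refine Continuous.integrable_of_hasCompactSupport ?_ ?_
        · exact (continuous_norm.pow k).mul
            (hsm.continuous_iteratedFDeriv (by exact_mod_cast le_top)).norm
        · exact ((hcs.iteratedFDeriv m).norm).mul_left)
      (k := 0) (n := n) le_top le_top (-w)
    rw [norm_iteratedFDeriv_zero, ← Real.fourierInv_eq_fourier_neg, norm_neg] at h
    refine h.trans ?_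
    simp only [pow_zero, Nat.cast_zero, mul_zero, zero_add, one_mul, Finset.range_one]
    gcongr
    · norm_num
    · calc _ ≤ ∑ p ∈ {0} ×ˢ Finset.range (n + 1), B * V := by
            refine Finset.sum_le_sum fun p hp => ?_
            rw [Finset.mem_product, Finset.mem_singleton, Finset.mem_range] at hp
            simp only [hp.1, pow_zero, one_mul]
            exact hint μ hμ hμ1 x p.2 (by omega)
        _ = (n + 1) * (B * V) := by simp
        _ ≤ (N + 1) * (B * V) := by gcongr
  refine ⟨2 ^ (N - 1) * (2 * (2 ^ N * ((N + 1) * (B * V)))), by positivity,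
    fun μ hμ hμ1 x w => ?_⟩
  have h0 := hpow μ hμ hμ1 x w 0 (Nat.zero_le _)
  have hN := hpow μ hμ hμ1 x w N le_rfl
  have h1 := add_pow_le (zero_le_one (α := ℝ)) (norm_nonneg w) N
  rw [one_pow] at h1
  rw [pow_zero] at h0
  calc _ ≤ 2 ^ (N - 1) * (1 + ‖w‖ ^ N) * ‖𝓕⁻ (packet ψ a χ μ x) w‖ := by gcongr
    _ = 2 ^ (N - 1) * (1 * ‖𝓕⁻ (packet ψ a χ μ x) w‖
        + ‖w‖ ^ N * ‖𝓕⁻ (packet ψ a χ μ x) w‖) := by ring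
    _ ≤ _ := by
      gcongr
      linarith

theorem fourierInv_eq_integral_packet {ψ : E → ℝ} {a χ : E → ℂ}
    (hψ : Continuous ψ) (ha : Continuous a) (hac : HasCompactSupport a)
    (hχ : Continuous χ) (hχc : HasCompactSupport χ) (hχ1 : ∫ η, χ η = 1)
    {μ : ℝ} (hμ : 0 < μ) (x : E) :
    𝓕⁻ (fun ξ => Complex.exp (Complex.I * (((μ ^ 2)⁻¹ * ψ ξ : ℝ) : ℂ)) * a ξ) x =
      ∫ ξ, Complex.exp (Complex.I * ((2 * π * inner ℝ ξ x + (μ ^ 2)⁻¹ * ψ ξ : ℝ) : ℂ)) *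
        𝓕⁻ (packet ψ a χ μ ξ) ((2 * π * μ)⁻¹ • (gradient ψ ξ + (2 * π * μ ^ 2) • x)) := by
  set F : E → ℂ := fun ξ =>
    Complex.exp (Complex.I * ((2 * π * inner ℝ ξ x + (μ ^ 2)⁻¹ * ψ ξ : ℝ) : ℂ)) * a ξ with hF
  have hFc : Continuous F := by fun_prop
  have hFi : Integrable F := hFc.integrable_of_hasCompactSupport hac.mul_left
  have hχi : Integrable χ := hχ.integrable_of_hasCompactSupport hχc
  have hG : Integrable (Function.uncurry fun η ξ => χ η * F (ξ + μ • η))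
      ((volume : Measure E).prod (volume : Measure E)) := by
    rw [integrable_prod_iff (by
      apply Continuous.aestronglyMeasurable
      simp only [Function.uncurry_def]
      fun_prop)]
    refine ⟨Filter.Eventually.of_forall fun η => ?_, ?_⟩
    · exact (hFi.comp_add_right (μ • η)).const_mul (χ η)
    · have : (fun η => ∫ ξ, ‖Function.uncurry (fun η ξ => χ η * F (ξ + μ • η)) (η, ξ)‖) =
          fun η => ‖χ η‖ * ∫ ξ, ‖F ξ‖ := by
        funext η
        simp only [Function.uncurry_apply_pair, norm_mul]
        rw [integral_const_mul, integral_add_right_eq_self (fun ξ => ‖F ξ‖)]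
      rw [this]
      exact hχi.norm.mul_const _
  calc 𝓕⁻ (fun ξ => Complex.exp (Complex.I * (((μ ^ 2)⁻¹ * ψ ξ : ℝ) : ℂ)) * a ξ) x
      = ∫ ξ, F ξ := by
        rw [Real.fourierInv_eq']
        refine integral_congr_ae (Filter.Eventually.of_forall fun ξ => ?_)
        simp only [hF, smul_eq_mul, ← mul_assoc, ← Complex.exp_add]
        congr 2
        push_cast
        ring
    _ = ∫ η, ∫ ξ, χ η * F (ξ + μ • η) := by
        simp_rw [integral_const_mul, integral_add_right_eq_self F]
        rw [integral_mul_const, hχ1, one_mul]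
    _ = ∫ ξ, ∫ η, χ η * F (ξ + μ • η) := integral_integral_swap hG
    _ = _ := by
        refine integral_congr_ae (Filter.Eventually.of_forall fun ξ => ?_)
        simp only [Real.fourierInv_eq']
        rw [← integral_const_mul]
        refine integral_congr_ae (Filter.Eventually.of_forall fun η => ?_)
        have hgrad : fderiv ℝ ψ ξ η = inner ℝ η (gradient ψ ξ) := by
          rw [real_inner_comm, gradient, InnerProductSpace.toDual_symm_apply]
        have hμ' : (μ : ℂ) ≠ 0 := by exact_mod_cast hμ.ne'
        have hπ : (π : ℂ) ≠ 0 := by exact_mod_cast Real.pi_ne_zero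
        simp only [hF, packet, zoomedRemainder, smul_eq_mul, hgrad]
        rw [← mul_assoc (Complex.exp _) (Complex.exp _) (_ * χ η), ← Complex.exp_add,
          ← mul_assoc (Complex.exp _) (Complex.exp _) (_ * χ η), ← Complex.exp_add]
        rw [mul_left_comm, mul_comm (χ η)]
        congr 2
        simp only [inner_add_left, inner_add_right, real_inner_smul_left, real_inner_smul_right]
        push_cast
        field_simp
        ring

/-- Dispersive decay `μ ^ dim E` for a frequency-localized phase `μ⁻² ψ` whose gradient map is
bi-Lipschitz near the support of the amplitude. -/
theorem exists_norm_fourierInv_cexp_mul_le {ψ : E → ℝ} {a : E → ℂ}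
    (hψ : ContDiff ℝ (⊤ : ℕ∞) ψ) (hψc : HasCompactSupport ψ)
    (ha : ContDiff ℝ (⊤ : ℕ∞) a) (hac : HasCompactSupport a)
    {K : Set E} (hK : IsCompact K) (hKne : K.Nonempty) {r : ℝ} (hr : 0 < r)
    (haK : ∀ ξ, a ξ ≠ 0 → Metric.closedBall ξ r ⊆ K) {L : ℝ} (hL : 0 < L)
    (hgrad : ∀ ξ ∈ K, ∀ ζ ∈ K, ‖ξ - ζ‖ ≤ L * ‖gradient ψ ξ - gradient ψ ζ‖) :
    ∃ C : ℝ, 0 ≤ C ∧ ∀ μ, 0 < μ → μ ≤ 1 → ∀ x,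
      ‖𝓕⁻ (fun ξ => Complex.exp (Complex.I * (((μ ^ 2)⁻¹ * ψ ξ : ℝ) : ℂ)) * a ξ) x‖ ≤
        C * μ ^ Module.finrank ℝ E := by
  let b : ContDiffBump (0 : E) := ⟨r / 2, r, by positivity, by linarith⟩
  set χ : E → ℂ := fun η => ((b.normed volume η : ℝ) : ℂ) with hχdef
  have hχ : ContDiff ℝ (⊤ : ℕ∞) χ := Complex.ofRealCLM.contDiff.comp b.contDiff_normed
  have hχr : ∀ η, χ η ≠ 0 → ‖η‖ ≤ r := by
    intro η hη
    have h1 : η ∈ Function.support (b.normed volume) := fun h => hη (by simp [hχdef, h])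
    rw [b.support_normed_eq] at h1
    exact (mem_ball_zero_iff.1 h1).le
  have hχc : HasCompactSupport χ :=
    b.hasCompactSupport_normed.comp_left (g := fun t : ℝ => (t : ℂ)) Complex.ofReal_zero
  have hχ1 : ∫ η, χ η = 1 := by
    rw [hχdef, integral_complex_ofReal, b.integral_normed]
    simp
  set N := Module.finrank ℝ E + 1 with hN
  obtain ⟨C, hC0, hC⟩ := exists_norm_fourierInv_packet_le hψ hψc ha hac hχ hχr N
  have hgc : Continuous (gradient ψ) :=
    (InnerProductSpace.toDual ℝ E).symm.continuous.comp (hψ.continuous_fderiv (by simp))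
  set J : E → ℝ := fun z => ((1 + ‖z‖) ^ N)⁻¹ with hJ
  have hJi : Integrable J := by
    have h := integrable_one_add_norm (E := E) (μ := volume) (r := (N : ℝ)) (by
      rw [hN]; push_cast; linarith)
    refine h.congr (Filter.Eventually.of_forall fun z => ?_)
    simp only [hJ]
    rw [Real.rpow_neg (by positivity), Real.rpow_natCast]
  have hJ0 : 0 ≤ ∫ z, J z := integral_nonneg fun z => by simp only [hJ]; positivity
  set κ : ℝ := (4 * π * L)⁻¹ with hκ
  have hκ0 : 0 < κ := by positivity
  clear_value κ
  refine ⟨C * ((κ⁻¹) ^ Module.finrank ℝ E * ∫ z, J z), by positivity, fun μ hμ hμ1 x => ?_⟩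
  rw [fourierInv_eq_integral_packet hψ.continuous ha.continuous hac hχ.continuous hχc hχ1 hμ]
  obtain ⟨ζ, hζK, hζ⟩ := hK.exists_isMinOn hKne
    (f := fun ξ => ‖gradient ψ ξ + (2 * π * μ ^ 2) • x‖) (by fun_prop)
  have hbd : ∀ ξ, ‖Complex.exp (Complex.I * ((2 * π * inner ℝ ξ x + (μ ^ 2)⁻¹ * ψ ξ : ℝ) : ℂ)) *
        𝓕⁻ (packet ψ a χ μ ξ) ((2 * π * μ)⁻¹ • (gradient ψ ξ + (2 * π * μ ^ 2) • x))‖ ≤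
      C * J ((κ * μ⁻¹) • (ξ - ζ)) := by
    intro ξ
    rw [norm_mul, mul_comm Complex.I, Complex.norm_exp_ofReal_mul_I, one_mul]
    set w := (2 * π * μ)⁻¹ • (gradient ψ ξ + (2 * π * μ ^ 2) • x) with hw
    by_cases hξ : ξ ∈ K
    · have h1 : ‖gradient ψ ζ + (2 * π * μ ^ 2) • x‖ ≤ ‖gradient ψ ξ + (2 * π * μ ^ 2) • x‖ :=
        hζ hξ
      have h2 := hgrad ξ hξ ζ hζK
      have h3 : ‖gradient ψ ξ - gradient ψ ζ‖ ≤
          ‖gradient ψ ξ + (2 * π * μ ^ 2) • x‖ + ‖gradient ψ ζ + (2 * π * μ ^ 2) • x‖ := by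
        rw [← add_sub_add_right_eq_sub _ _ ((2 * π * μ ^ 2) • x)]
        exact norm_sub_le _ _
      have h4 : ‖w‖ = (2 * π * μ)⁻¹ * ‖gradient ψ ξ + (2 * π * μ ^ 2) • x‖ := by
        rw [hw, norm_smul, Real.norm_of_nonneg (by positivity)]
      have h5 : ‖(κ * μ⁻¹) • (ξ - ζ)‖ ≤ ‖w‖ := by
        rw [norm_smul, Real.norm_of_nonneg (by positivity), h4]
        calc κ * μ⁻¹ * ‖ξ - ζ‖
            ≤ κ * μ⁻¹ * (L * (2 * ‖gradient ψ ξ + (2 * π * μ ^ 2) • x‖)) := by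
              gcongr
              refine h2.trans ?_
              gcongr
              linarith
          _ = _ := by
              rw [hκ]
              field_simp
              ring
      have h6 := hC μ hμ hμ1 ξ w
      simp only [hJ]
      rw [← div_eq_mul_inv, le_div_iff₀ (by positivity), mul_comm]
      refine le_trans ?_ h6
      gcongr
    · have h0 : packet ψ a χ μ ξ = fun _ => 0 := by
        funext η
        by_cases hη : χ η = 0
        · exact packet_eq_zero hη
        · have h1 : a (ξ + μ • η) = 0 := by
            by_contra h
            refine hξ (haK _ h ?_)
            rw [Metric.mem_closedBall, dist_eq_norm]
            have h2 := hχr η hη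
            rw [sub_add_cancel_left, norm_neg, norm_smul, Real.norm_of_nonneg hμ.le]
            calc μ * ‖η‖ ≤ 1 * r := by gcongr
              _ = r := one_mul r
          simp [packet, h1]
      rw [h0]
      simp only [Real.fourierInv_eq, smul_zero, integral_zero, norm_zero]
      simp only [hJ]
      positivity
  have hcomp : Integrable (fun ξ => J ((κ * μ⁻¹) • (ξ - ζ))) :=
    ((integrable_comp_smul_iff volume J (by positivity : κ * μ⁻¹ ≠ 0)).2 hJi).comp_sub_right ζ
  refine (norm_integral_le_of_norm_le (hcomp.const_mul C)
    (Filter.Eventually.of_forall hbd)).trans (le_of_eq ?_)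
  rw [integral_const_mul, integral_sub_right_eq_self (fun ξ => J ((κ * μ⁻¹) • ξ)),
    Measure.integral_comp_smul, smul_eq_mul, abs_of_pos (by positivity)]
  rw [← inv_pow, mul_inv, inv_inv μ, mul_pow]
  ring

/-- Fourier multiplication theorem for inverse transforms. -/
theorem integral_fourierInv_mul_fourierInv_sub {a b : E → ℂ} (ha : ContDiff ℝ (⊤ : ℕ∞) a)
    (hac : HasCompactSupport a) (hb : Integrable b) (x : E) :
    ∫ y, 𝓕⁻ a y * 𝓕⁻ b (x - y) = 𝓕⁻ (fun ξ => a ξ * b ξ) x := by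
  set S := hac.toSchwartzMap ha with hS
  have hSa : (S : E → ℂ) = a := rfl
  have hinv : 𝓕 (𝓕⁻ a) = a := by
    have h : 𝓕 (𝓕⁻ S) = S := FourierTransform.fourier_fourierInv_eq S
    rw [← hSa, ← SchwartzMap.fourierInv_coe, ← SchwartzMap.fourier_coe, h]
  have hint : Integrable (𝓕⁻ a) := by
    rw [← hSa, ← SchwartzMap.fourierInv_coe]
    exact (𝓕⁻ S).integrable
  set f : E → ℂ := fun ξ => Real.fourierChar (inner ℝ ξ x) • b ξ with hf
  have hfi : Integrable f := by
    refine (integrable_norm_iff ?_).1 ?_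
    · exact (Continuous.aestronglyMeasurable (by fun_prop)).smul hb.aestronglyMeasurable
    · refine hb.norm.congr (Filter.Eventually.of_forall fun ξ => ?_)
      simp only [hf, Circle.smul_def, smul_eq_mul, norm_mul]
      rw [Circle.norm_coe, one_mul]
  have hfb : ∀ y, 𝓕⁻ b (x - y) = 𝓕 f y := by
    intro y
    rw [Real.fourierInv_eq, Real.fourier_eq]
    refine integral_congr_ae (Filter.Eventually.of_forall fun ξ => ?_)
    simp only [hf]
    rw [smul_smul, ← AddChar.map_add_eq_mul, inner_sub_right]
    congr 2
    ring
  have key := VectorFourier.integral_fourierIntegral_smul_eq_flip (L := innerₗ E)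
    Real.continuous_fourierChar continuous_inner hfi hint
  rw [flip_innerₗ] at key
  calc ∫ y, 𝓕⁻ a y * 𝓕⁻ b (x - y) = ∫ y, 𝓕 f y • 𝓕⁻ a y := by
        refine integral_congr_ae (Filter.Eventually.of_forall fun y => ?_)
        simp only [hfb, smul_eq_mul, mul_comm]
    _ = ∫ y, f y • 𝓕 (𝓕⁻ a) y := key
    _ = _ := by
        rw [hinv, Real.fourierInv_eq]
        refine integral_congr_ae (Filter.Eventually.of_forall fun ξ => ?_)
        simp only [hf, Circle.smul_def, smul_eq_mul]
        ring

theorem fourierInv_comp_smul (H : E → ℂ) {c : ℝ} (hc : 0 < c) (x : E) :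
    𝓕⁻ (fun ξ => H (c⁻¹ • ξ)) x = (c ^ Module.finrank ℝ E : ℝ) * 𝓕⁻ H (c • x) := by
  simp only [Real.fourierInv_eq]
  have h := Measure.integral_comp_smul (volume : Measure E)
    (fun η => Real.fourierChar (inner ℝ η (c • x)) • H η) c⁻¹
  rw [← inv_pow, inv_inv, abs_of_pos (by positivity)] at h
  rw [← Complex.real_smul, ← h]
  refine integral_congr_ae (Filter.Eventually.of_forall fun ξ => ?_)
  simp only [real_inner_smul_left, real_inner_smul_right]
  rw [mul_inv_cancel_left₀ hc.ne']

theorem continuous_fourierInv {b : E → ℂ} (hb : Integrable b) : Continuous (𝓕⁻ b) :=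
  VectorFourier.fourierIntegral_continuous Real.continuous_fourierChar
    (continuous_inner.neg) hb

theorem norm_fourierInv_le (b : E → ℂ) (x : E) : ‖𝓕⁻ b x‖ ≤ ∫ ξ, ‖b ξ‖ :=
  VectorFourier.norm_fourierIntegral_le_integral_norm _ _ _ _ _

end Dispersion

section PowerPhase

variable {E : Type*} [NormedAddCommGroup E] [InnerProductSpace ℝ E]

theorem contDiff_mul_of_eventually_eq_zero {A : Type*} [NormedRing A] [NormedAlgebra ℝ A]
    {f g : E → A} (hf : ∀ ξ, ξ ≠ 0 → ContDiffAt ℝ (⊤ : ℕ∞) f ξ) (hg : ContDiff ℝ (⊤ : ℕ∞) g)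
    (h : ∀ᶠ ξ in nhds 0, g ξ = 0) : ContDiff ℝ (⊤ : ℕ∞) (fun ξ => f ξ * g ξ) := by
  rw [contDiff_iff_contDiffAt]
  intro ξ
  by_cases hξ : ξ = 0
  · subst hξ
    refine (contDiffAt_const (c := (0 : A))).congr_of_eventuallyEq ?_
    filter_upwards [h] with η hη
    rw [hη, mul_zero]
  · exact (hf ξ hξ).mul hg.contDiffAt

theorem contDiffAt_norm_rpow (α : ℝ) {ξ : E} (hξ : ξ ≠ 0) :
    ContDiffAt ℝ (⊤ : ℕ∞) (fun ξ : E => ‖ξ‖ ^ α) ξ :=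
  (contDiffAt_norm ℝ hξ).rpow_const_of_ne (norm_ne_zero_iff.2 hξ)

theorem hasFDerivAt_norm_rpow_of_ne (α : ℝ) {ξ : E} (hξ : ξ ≠ 0) :
    HasFDerivAt (fun ξ : E => ‖ξ‖ ^ α) ((α * ‖ξ‖ ^ (α - 2)) • innerSL ℝ ξ) ξ := by
  have hpos : 0 < ‖ξ‖ := norm_pos_iff.2 hξ
  have h := (hasStrictFDerivAt_norm_sq ξ).hasFDerivAt.rpow_const (p := α / 2)
    (Or.inl (by positivity))
  have heq : (fun ξ : E => (‖ξ‖ ^ 2) ^ (α / 2)) = fun ξ : E => ‖ξ‖ ^ α := by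
    funext η
    rw [← Real.rpow_natCast, ← Real.rpow_mul (norm_nonneg η)]
    congr 1
    push_cast
    ring
  rw [heq] at h
  refine h.congr_fderiv ?_
  ext v
  have hp : (‖ξ‖ ^ 2) ^ (α / 2 - 1) = ‖ξ‖ ^ (α - 2) := by
    rw [← Real.rpow_natCast, ← Real.rpow_mul (norm_nonneg ξ)]
    congr 1
    push_cast
    ring
  simp [hp]
  ring

theorem gradient_mul_norm_rpow [CompleteSpace E] (t α : ℝ) {ξ : E} (hξ : ξ ≠ 0) :
    gradient (fun ξ : E => t * ‖ξ‖ ^ α) ξ = (t * α * ‖ξ‖ ^ (α - 2)) • ξ := by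
  rw [gradient, ((hasFDerivAt_norm_rpow_of_ne α hξ).const_mul t).fderiv,
    LinearIsometryEquiv.symm_apply_eq]
  ext v
  simp
  ring

/-- For `α ≠ 1` the gradient map of `t ‖ξ‖ ^ α` has a smooth local inverse away from the origin. -/
theorem norm_rpow_smul_leftInverse {t α : ℝ} (ht : t ≠ 0) (hα : α ≠ 0) (hα1 : α ≠ 1) {ξ : E}
    (hξ : ξ ≠ 0) :
    ‖(t * α)⁻¹ • (t * α * ‖ξ‖ ^ (α - 2)) • ξ‖ ^ ((2 - α) / (α - 1)) •
      ((t * α)⁻¹ • (t * α * ‖ξ‖ ^ (α - 2)) • ξ) = ξ := by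
  have hpos : 0 < ‖ξ‖ := norm_pos_iff.2 hξ
  have hα1' : α - 1 ≠ 0 := sub_ne_zero.2 hα1
  rw [smul_smul (t * α)⁻¹, inv_mul_cancel_left₀ (mul_ne_zero ht hα), norm_smul,
    Real.norm_of_nonneg (by positivity)]
  have h1 : ‖ξ‖ ^ (α - 2) * ‖ξ‖ = ‖ξ‖ ^ (α - 1) := by
    rw [← Real.rpow_add_one hpos.ne']
    congr 1
    ring
  rw [h1, ← Real.rpow_mul hpos.le, mul_div_cancel₀ _ hα1', smul_smul, ← Real.rpow_add hpos]
  simp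

theorem exists_localized_power_phase [FiniteDimensional ℝ E] {t α : ℝ} (ht : t ≠ 0) (hα : α ≠ 0)
    (hα1 : α ≠ 1) {ξ₀ : E} (hξ₀ : ξ₀ ≠ 0) :
    ∃ ψ : E → ℝ, ContDiff ℝ (⊤ : ℕ∞) ψ ∧ HasCompactSupport ψ ∧ ∃ ρ > 0, ∃ L > 0,
      (∀ ξ ∈ Metric.closedBall ξ₀ ρ, ψ ξ = t * ‖ξ‖ ^ α) ∧
      ∀ ξ ∈ Metric.closedBall ξ₀ ρ, ∀ ζ ∈ Metric.closedBall ξ₀ ρ,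
        ‖ξ - ζ‖ ≤ L * ‖gradient ψ ξ - gradient ψ ζ‖ := by
  have hpos : 0 < ‖ξ₀‖ := norm_pos_iff.2 hξ₀
  let c : ContDiffBump ξ₀ := ⟨‖ξ₀‖ / 4, ‖ξ₀‖ / 2, by positivity, by linarith⟩
  set ψ : E → ℝ := fun ξ => (t * ‖ξ‖ ^ α) * c ξ with hψdef
  have hne : ∀ ξ ∈ Metric.ball ξ₀ (‖ξ₀‖ / 4), ξ ≠ 0 := by
    rintro ξ hξ rfl
    rw [Metric.mem_ball, dist_zero_left] at hξ
    linarith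
  have hψeq : ∀ ξ ∈ Metric.ball ξ₀ (‖ξ₀‖ / 4), ψ ξ = t * ‖ξ‖ ^ α := fun ξ hξ => by
    simp only [hψdef]
    rw [c.one_of_mem_closedBall (Metric.ball_subset_closedBall hξ), mul_one]
  have hg : ∀ ξ ∈ Metric.ball ξ₀ (‖ξ₀‖ / 4),
      gradient ψ ξ = (t * α * ‖ξ‖ ^ (α - 2)) • ξ := fun ξ hξ => by
    rw [← gradient_mul_norm_rpow t α (hne ξ hξ)]
    refine Filter.EventuallyEq.gradient_eq ?_
    filter_upwards [Metric.isOpen_ball.mem_nhds hξ] with η hη using hψeq η hη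
  have hψ : ContDiff ℝ (⊤ : ℕ∞) ψ := by
    refine contDiff_mul_of_eventually_eq_zero
      (fun ξ hξ => contDiffAt_const.mul (contDiffAt_norm_rpow α hξ)) c.contDiff ?_
    have : Metric.ball (0 : E) (‖ξ₀‖ / 2) ∈ nhds 0 := Metric.ball_mem_nhds _ (by positivity)
    filter_upwards [this] with ξ hξ
    refine c.zero_of_le_dist ?_
    rw [mem_ball_zero_iff] at hξ
    rw [dist_comm, dist_eq_norm]
    have := norm_sub_norm_le ξ₀ ξ
    change ‖ξ₀‖ / 2 ≤ _
    linarith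
  have hψc : HasCompactSupport ψ := c.hasCompactSupport.mul_left
  set h : E → E := fun z => ‖(t * α)⁻¹ • z‖ ^ ((2 - α) / (α - 1)) • ((t * α)⁻¹ • z) with hh
  have hleft : ∀ ξ ∈ Metric.ball ξ₀ (‖ξ₀‖ / 4), h (gradient ψ ξ) = ξ := fun ξ hξ => by
    rw [hg ξ hξ]
    exact norm_rpow_smul_leftInverse ht hα hα1 (hne ξ hξ)
  have h0 : ξ₀ ∈ Metric.ball ξ₀ (‖ξ₀‖ / 4) := Metric.mem_ball_self (by positivity)
  have hz0 : (t * α)⁻¹ • gradient ψ ξ₀ ≠ 0 := by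
    intro hz
    have := hleft ξ₀ h0
    simp only [hh, hz, smul_zero] at this
    exact hξ₀ this.symm
  have hhc : ContDiffAt ℝ 1 h (gradient ψ ξ₀) := by
    have hs : ContDiffAt ℝ 1 (fun z : E => (t * α)⁻¹ • z) (gradient ψ ξ₀) :=
      contDiffAt_const.smul contDiffAt_id
    have hn : ContDiffAt ℝ 1 (fun ξ : E => ‖ξ‖ ^ ((2 - α) / (α - 1)))
        ((t * α)⁻¹ • gradient ψ ξ₀) :=
      (contDiffAt_norm_rpow _ hz0).of_le (by exact_mod_cast le_top)
    exact (ContDiffAt.comp (f := fun z : E => (t * α)⁻¹ • z) (gradient ψ ξ₀) hn hs).smul hs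
  obtain ⟨M, s, hs, hM⟩ := hhc.exists_lipschitzOnWith
  have hgc : Continuous (gradient ψ) :=
    (InnerProductSpace.toDual ℝ E).symm.continuous.comp (hψ.continuous_fderiv (by simp))
  have hnhds : gradient ψ ⁻¹' s ∩ Metric.ball ξ₀ (‖ξ₀‖ / 4) ∈ nhds ξ₀ :=
    Filter.inter_mem (hgc.continuousAt hs) (Metric.ball_mem_nhds _ (by positivity))
  obtain ⟨ρ, hρ, hsub⟩ := Metric.nhds_basis_closedBall.mem_iff.1 hnhds
  refine ⟨ψ, hψ, hψc, ρ, hρ, M + 1, by positivity, fun ξ hξ => hψeq ξ (hsub hξ).2,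
    fun ξ hξ ζ hζ => ?_⟩
  have h1 := hM.norm_sub_le (hsub hξ).1 (hsub hζ).1
  rw [hleft ξ (hsub hξ).2, hleft ζ (hsub hζ).2] at h1
  refine h1.trans ?_
  gcongr
  linarith

end PowerPhase

section LittlewoodPaley

variable {d : ℕ}

theorem symbolOp_fourierInv {ψ : EuclideanSpace ℝ (Fin d) → ℝ} (hψ : ContDiff ℝ (⊤ : ℕ∞) ψ)
    (hψc : HasCompactSupport ψ) {b : EuclideanSpace ℝ (Fin d) → ℂ} (hb : Integrable b) :
    symbolOp d ψ (𝓕⁻ b) = 𝓕⁻ (fun ξ => (ψ ξ : ℂ) * b ξ) :=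
  funext fun x => integral_fourierInv_mul_fourierInv_sub (a := fun ξ => (ψ ξ : ℂ))
    (Complex.ofRealCLM.contDiff.comp hψ)
    (hψc.comp_left (g := fun t : ℝ => (t : ℂ)) Complex.ofReal_zero) hb x

theorem contDiff_dyadic {φ : EuclideanSpace ℝ (Fin d) → ℝ} (hφ : ContDiff ℝ (⊤ : ℕ∞) φ) (j : ℕ) :
    ContDiff ℝ (⊤ : ℕ∞) (dyadic d φ j) :=
  hφ.comp (contDiff_const_smul ((2 : ℝ) ^ j)⁻¹)

theorem hasCompactSupport_dyadic {φ : EuclideanSpace ℝ (Fin d) → ℝ} (hφ : HasCompactSupport φ)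
    (j : ℕ) : HasCompactSupport (dyadic d φ j) :=
  hφ.comp_smul (by positivity)

theorem dyadic_ne_zero_bounds {φ : EuclideanSpace ℝ (Fin d) → ℝ}
    (hφsupp : ∀ ξ, φ ξ ≠ 0 → 1 / 2 ≤ ‖ξ‖ ∧ ‖ξ‖ ≤ 2) {j : ℕ} {ξ : EuclideanSpace ℝ (Fin d)}
    (h : dyadic d φ j ξ ≠ 0) : (2 : ℝ) ^ j ≤ 2 * ‖ξ‖ ∧ ‖ξ‖ ≤ 2 * 2 ^ j := by
  obtain ⟨h1, h2⟩ := hφsupp _ h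
  rw [norm_smul, norm_inv, norm_pow, Real.norm_ofNat, ← div_eq_inv_mul] at h1 h2
  rw [div_le_div_iff₀ (by norm_num) (by positivity)] at h1
  rw [div_le_iff₀ (by positivity)] at h2
  constructor <;> linarith

theorem dyadic_mul_dyadic_eq_zero {φ : EuclideanSpace ℝ (Fin d) → ℝ}
    (hφsupp : ∀ ξ, φ ξ ≠ 0 → 1 / 2 ≤ ‖ξ‖ ∧ ‖ξ‖ ≤ 2) {j k : ℕ} (hjk : j + 2 < k ∨ k + 2 < j)
    (ξ : EuclideanSpace ℝ (Fin d)) : dyadic d φ k ξ * dyadic d φ j ξ = 0 := by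
  by_contra h
  obtain ⟨hk, hj⟩ := mul_ne_zero_iff.1 h
  obtain ⟨k1, k2⟩ := dyadic_ne_zero_bounds hφsupp hk
  obtain ⟨j1, j2⟩ := dyadic_ne_zero_bounds hφsupp hj
  have hpos : ∀ n : ℕ, (0 : ℝ) < 2 ^ n := fun n => by positivity
  rcases hjk with h | h
  · have : (2 : ℝ) ^ (j + 3) ≤ 2 ^ k := pow_le_pow_right₀ (by norm_num) h
    rw [pow_add] at this
    linarith [hpos j]
  · have : (2 : ℝ) ^ (k + 3) ≤ 2 ^ j := pow_le_pow_right₀ (by norm_num) h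
    rw [pow_add] at this
    linarith [hpos k]

theorem exists_ne_zero_of_partition (hd : 1 ≤ d) {χl φ : EuclideanSpace ℝ (Fin d) → ℝ}
    (hχlsupp : ∀ ξ, χl ξ ≠ 0 → ‖ξ‖ ≤ 1) (hpart : ∀ ξ, χl ξ + ∑' j : ℕ, dyadic d φ j ξ = 1) :
    ∃ ξ, φ ξ ≠ 0 := by
  by_contra! h
  set ξ : EuclideanSpace ℝ (Fin d) := EuclideanSpace.single ⟨0, hd⟩ 2
  have hξ : ‖ξ‖ = 2 := by simp [ξ]
  have h1 : χl ξ = 0 := by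
    by_contra hne
    have := hχlsupp ξ hne
    linarith
  have h2 := hpart ξ
  simp [h1, dyadic, h] at h2

/-- Frequency profile of the focusing data at frequency scale `2 ^ j`. -/
def focusingProfile (d : ℕ) (t α : ℝ) (θ : EuclideanSpace ℝ (Fin d) → ℝ) (j : ℕ)
    (ξ : EuclideanSpace ℝ (Fin d)) : ℂ :=
  Complex.exp (Complex.I * ((t * ‖ξ‖ ^ α : ℝ) : ℂ)) * (dyadic d θ j ξ : ℂ)

theorem continuous_focusingProfile {t α : ℝ} (hα : 0 < α) {θ : EuclideanSpace ℝ (Fin d) → ℝ}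
    (hθ : Continuous θ) (j : ℕ) : Continuous (focusingProfile d t α θ j) := by
  have h1 : Continuous fun ξ : EuclideanSpace ℝ (Fin d) => ‖ξ‖ ^ α :=
    continuous_norm.rpow_const fun _ => Or.inr hα.le
  have h2 : Continuous (dyadic d θ j) := hθ.comp (continuous_const_smul _)
  unfold focusingProfile
  fun_prop

theorem hasCompactSupport_focusingProfile (t α : ℝ) {θ : EuclideanSpace ℝ (Fin d) → ℝ}
    (hθ : HasCompactSupport θ) (j : ℕ) : HasCompactSupport (focusingProfile d t α θ j) :=
  ((hasCompactSupport_dyadic hθ j).comp_left (g := fun t : ℝ => (t : ℂ))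
    Complex.ofReal_zero).mul_left

theorem contDiff_propagator_dyadic (t α : ℝ) {φ : EuclideanSpace ℝ (Fin d) → ℝ}
    (hφ : ContDiff ℝ (⊤ : ℕ∞) φ) (hφsupp : ∀ ξ, φ ξ ≠ 0 → 1 / 2 ≤ ‖ξ‖ ∧ ‖ξ‖ ≤ 2) (j : ℕ) :
    ContDiff ℝ (⊤ : ℕ∞) (fun ξ : EuclideanSpace ℝ (Fin d) =>
      Complex.exp (-Complex.I * (t : ℂ) * ((‖ξ‖ ^ α : ℝ) : ℂ)) * (dyadic d φ j ξ : ℂ)) := by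
  refine contDiff_mul_of_eventually_eq_zero (fun ξ hξ => ?_)
    (Complex.ofRealCLM.contDiff.comp (contDiff_dyadic hφ j)) ?_
  · exact (contDiffAt_const.mul
      (Complex.ofRealCLM.contDiff.contDiffAt.comp ξ (contDiffAt_norm_rpow α hξ))).cexp
  · have : Metric.ball (0 : EuclideanSpace ℝ (Fin d)) (2 ^ j / 2) ∈ nhds 0 :=
      Metric.ball_mem_nhds _ (by positivity)
    filter_upwards [this] with ξ hξ
    rw [mem_ball_zero_iff] at hξ
    have h0 : dyadic d φ j ξ = 0 := by
      by_contra h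
      have := (dyadic_ne_zero_bounds hφsupp h).1
      linarith
    simp [h0]

theorem coe_nnnorm_eq_ofReal (z : ℂ) : (‖z‖₊ : ℝ≥0∞) = ENNReal.ofReal ‖z‖ := by
  rw [ofReal_norm]
  rfl

/-- Upper bound for the Zygmund norm of a function with frequencies near `2 ^ j`. -/
theorem zygNorm_le_of_localized {χl φ : EuclideanSpace ℝ (Fin d) → ℝ} (σ : ℝ)
    {v : EuclideanSpace ℝ (Fin d) → ℂ} {j : ℕ} {B : ℝ} (hlow : symbolOp d χl v = 0)
    (hfar : ∀ k, j + 2 < k ∨ k + 2 < j → symbolOp d (dyadic d φ k) v = 0)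
    (hB : ∀ k, k ≤ j + 2 → j ≤ k + 2 → ∀ x, ‖symbolOp d (dyadic d φ k) v x‖ ≤ B) :
    zygNorm d χl φ σ v ≤
      ENNReal.ofReal (2 ^ ((j : ℝ) * σ) * 2 ^ (2 * |σ|) * B) := by
  unfold zygNorm
  refine sup_le (iSup_le fun x => by simp [hlow]) (iSup_le fun k => ?_)
  by_cases hk : j + 2 < k ∨ k + 2 < j
  · simp [hfar k hk]
  · push Not at hk
    have hsup : (⨆ x, (‖symbolOp d (dyadic d φ k) v x‖₊ : ℝ≥0∞)) ≤ ENNReal.ofReal B := by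
      refine iSup_le fun x => ?_
      rw [coe_nnnorm_eq_ofReal]
      exact ENNReal.ofReal_le_ofReal (hB k hk.1 hk.2 x)
    have hB0 : 0 ≤ B := (norm_nonneg _).trans (hB k hk.1 hk.2 0)
    calc _ ≤ ENNReal.ofReal (2 ^ ((k : ℝ) * σ)) * ENNReal.ofReal B := by gcongr
      _ = ENNReal.ofReal (2 ^ ((k : ℝ) * σ) * B) := (ENNReal.ofReal_mul (by positivity)).symm
      _ ≤ _ := by
        refine ENNReal.ofReal_le_ofReal ?_
        gcongr
        rw [← Real.rpow_add (by norm_num)]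
        refine Real.rpow_le_rpow_of_exponent_le (by norm_num) ?_
        have h1 : ((k : ℝ) - j) * σ ≤ 2 * |σ| := by
          refine (le_abs_self _).trans ?_
          rw [abs_mul]
          gcongr
          have e1 : (k : ℝ) ≤ j + 2 := by exact_mod_cast hk.1
          have e2 : (j : ℝ) ≤ k + 2 := by exact_mod_cast hk.2
          rw [abs_le]
          constructor <;> linarith
        linarith

theorem le_zygNorm (χl φ : EuclideanSpace ℝ (Fin d) → ℝ) (s : ℝ)
    (v : EuclideanSpace ℝ (Fin d) → ℂ) (j : ℕ) (x : EuclideanSpace ℝ (Fin d)) :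
    ENNReal.ofReal (2 ^ ((j : ℝ) * s) * ‖symbolOp d (dyadic d φ j) v x‖) ≤
      zygNorm d χl φ s v := by
  rw [ENNReal.ofReal_mul (by positivity), ← coe_nnnorm_eq_ofReal]
  refine le_trans ?_ le_sup_right
  refine le_trans ?_ (le_iSup _ j)
  gcongr
  exact le_iSup (fun x => (‖symbolOp d (dyadic d φ j) v x‖₊ : ℝ≥0∞)) x

theorem inv_sq_two_rpow (α : ℝ) (j : ℕ) :
    (((2 : ℝ) ^ (-(j * α / 2))) ^ 2)⁻¹ = ((2 : ℝ) ^ j) ^ α := by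
  rw [← Real.rpow_natCast, ← Real.rpow_mul (by norm_num), ← Real.rpow_neg (by norm_num),
    ← Real.rpow_natCast, ← Real.rpow_mul (by norm_num)]
  congr 1
  push_cast
  ring

/-- Dispersive decay of the Littlewood–Paley pieces of the focusing data. -/
theorem exists_norm_fourierInv_focusingProfile_le {t α : ℝ} (ht : t ≠ 0) (hα : 0 < α)
    (hα1 : α ≠ 1) {φ : EuclideanSpace ℝ (Fin d) → ℝ} (hφ : ContDiff ℝ (⊤ : ℕ∞) φ)
    {ξ₀ : EuclideanSpace ℝ (Fin d)} (hξ₀ : ξ₀ ≠ 0) :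
    ∃ θ : ContDiffBump ξ₀, ∃ B : ℝ, 0 ≤ B ∧ ∀ j k : ℕ, k ≤ j + 2 → j ≤ k + 2 → ∀ x,
      ‖𝓕⁻ (fun ξ => (dyadic d φ k ξ : ℂ) * ((dyadic d φ j ξ : ℂ) *
        focusingProfile d t α θ j ξ)) x‖ ≤
        B * (((2 : ℝ) ^ j) ^ d * ((2 : ℝ) ^ (-(j * α / 2))) ^ d) := by
  obtain ⟨ψ, hψ, hψc, ρ, hρ, L, hL, hψeq, hgrad⟩ :=
    exists_localized_power_phase ht hα.ne' hα1 hξ₀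
  let θ : ContDiffBump ξ₀ := ⟨ρ / 4, ρ / 2, by positivity, by linarith⟩
  have hθr : ∀ ξ, θ ξ ≠ 0 → ξ ∈ Metric.ball ξ₀ (ρ / 2) := fun ξ hξ => by
    have : ξ ∈ Function.support θ := hξ
    rwa [θ.support_eq] at this
  set a : ℤ → EuclideanSpace ℝ (Fin d) → ℂ := fun m η =>
    ((θ η * (φ η * φ (((2 : ℝ) ^ m) • η)) : ℝ) : ℂ) with ha
  have hdisp : ∀ m : ℤ, ∃ C : ℝ, 0 ≤ C ∧ ∀ μ, 0 < μ → μ ≤ 1 → ∀ x,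
      ‖𝓕⁻ (fun ξ => Complex.exp (Complex.I * (((μ ^ 2)⁻¹ * ψ ξ : ℝ) : ℂ)) * a m ξ) x‖ ≤
        C * μ ^ d := by
    intro m
    have hsm : ContDiff ℝ (⊤ : ℕ∞) (a m) := by
      have hθ : ContDiff ℝ (⊤ : ℕ∞) θ := θ.contDiff
      have hφm : ContDiff ℝ (⊤ : ℕ∞) (fun η => φ (((2 : ℝ) ^ m) • η)) :=
        hφ.comp (contDiff_const_smul ((2 : ℝ) ^ m))
      exact Complex.ofRealCLM.contDiff.comp (hθ.mul (hφ.mul hφm))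
    have hcs : HasCompactSupport (a m) :=
      (θ.hasCompactSupport.mul_right).comp_left (g := fun t : ℝ => (t : ℂ)) Complex.ofReal_zero
    have := exists_norm_fourierInv_cexp_mul_le hψ hψc hsm hcs
      (isCompact_closedBall ξ₀ ρ) ⟨ξ₀, Metric.mem_closedBall_self hρ.le⟩ (half_pos hρ)
      (fun ξ hξ => by
        have h1 : θ ξ ≠ 0 := fun h => hξ (by simp [ha, h])
        have h2 := hθr ξ h1
        rw [Metric.mem_ball] at h2
        exact Metric.closedBall_subset_closedBall' (by linarith)) hL hgrad
    rwa [finrank_euclideanSpace_fin] at this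
  choose C hC0 hC using hdisp
  refine ⟨θ, ∑ m ∈ Finset.Icc (-2 : ℤ) 2, C m, Finset.sum_nonneg fun m _ => hC0 m,
    fun j k hkj hjk x => ?_⟩
  set μ : ℝ := (2 : ℝ) ^ (-(j * α / 2)) with hμ
  have hμ0 : 0 < μ := by positivity
  have hμ1 : μ ≤ 1 := Real.rpow_le_one_of_one_le_of_nonpos (by norm_num)
    (neg_nonpos.2 (by positivity))
  have hscale : (fun ξ => (dyadic d φ k ξ : ℂ) * ((dyadic d φ j ξ : ℂ) *
        focusingProfile d t α θ j ξ)) = fun ξ =>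
      (fun η => Complex.exp (Complex.I * (((μ ^ 2)⁻¹ * ψ η : ℝ) : ℂ)) * a (j - k) η)
        (((2 : ℝ) ^ j)⁻¹ • ξ) := by
    funext ξ
    simp only [focusingProfile, dyadic, ha]
    set η := ((2 : ℝ) ^ j)⁻¹ • ξ with hη
    have hξη : ξ = (2 : ℝ) ^ j • η := by
      rw [hη, smul_smul, mul_inv_cancel₀ (by positivity), one_smul]
    by_cases h0 : θ η = 0
    · simp [h0]
    · have h1 : ψ η = t * ‖η‖ ^ α :=
        hψeq η (Metric.closedBall_subset_closedBall (by linarith)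
          (Metric.ball_subset_closedBall (hθr η h0)))
      have h2 : ((2 : ℝ) ^ k)⁻¹ • ξ = ((2 : ℝ) ^ ((j : ℤ) - k)) • η := by
        rw [hξη, smul_smul, zpow_sub₀ (by norm_num), zpow_natCast, zpow_natCast, div_eq_inv_mul]
      have h3 : t * ‖ξ‖ ^ α = (μ ^ 2)⁻¹ * ψ η := by
        rw [h1, hμ, inv_sq_two_rpow, hξη, norm_smul, norm_pow, Real.norm_ofNat,
          Real.mul_rpow (by positivity) (norm_nonneg _)]
        ring
      rw [h2, h3]
      push_cast
      ring
  rw [hscale, fourierInv_comp_smul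
    (fun η => Complex.exp (Complex.I * (((μ ^ 2)⁻¹ * ψ η : ℝ) : ℂ)) * a (j - k) η)
    (show (0 : ℝ) < 2 ^ j by positivity), norm_mul, finrank_euclideanSpace_fin,
    Complex.norm_real, Real.norm_of_nonneg (by positivity)]
  have hm : C (j - k) ≤ ∑ m ∈ Finset.Icc (-2 : ℤ) 2, C m :=
    Finset.single_le_sum (fun m _ => hC0 m) (Finset.mem_Icc.2 ⟨by omega, by omega⟩)
  calc _ ≤ ((2 : ℝ) ^ j) ^ d * (C (j - k) * μ ^ d) := by
        gcongr
        exact hC _ μ hμ0 hμ1 _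
    _ ≤ ((2 : ℝ) ^ j) ^ d * ((∑ m ∈ Finset.Icc (-2 : ℤ) 2, C m) * μ ^ d) := by gcongr
    _ = _ := by ring

theorem fourierInv_refocused {t α : ℝ} (φ θ : EuclideanSpace ℝ (Fin d) → ℝ) (j : ℕ) :
    𝓕⁻ (fun ξ => (dyadic d φ j ξ : ℂ) *
      ((Complex.exp (-Complex.I * (t : ℂ) * ((‖ξ‖ ^ α : ℝ) : ℂ)) * (dyadic d φ j ξ : ℂ)) *
        focusingProfile d t α θ j ξ)) 0 =
      ((((2 : ℝ) ^ j) ^ d * ∫ η, φ η ^ 2 * θ η : ℝ) : ℂ) := by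
  have hscale : (fun ξ => (dyadic d φ j ξ : ℂ) *
      ((Complex.exp (-Complex.I * (t : ℂ) * ((‖ξ‖ ^ α : ℝ) : ℂ)) * (dyadic d φ j ξ : ℂ)) *
        focusingProfile d t α θ j ξ)) = fun ξ =>
      (fun η => ((φ η ^ 2 * θ η : ℝ) : ℂ)) (((2 : ℝ) ^ j)⁻¹ • ξ) := by
    funext ξ
    have hexp : Complex.exp (-Complex.I * (t : ℂ) * ((‖ξ‖ ^ α : ℝ) : ℂ)) *
        Complex.exp (Complex.I * ((t * ‖ξ‖ ^ α : ℝ) : ℂ)) = 1 := by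
      rw [← Complex.exp_add, ← Complex.exp_zero]
      congr 1
      push_cast
      ring
    simp only [focusingProfile, dyadic]
    push_cast
    push_cast at hexp
    linear_combination (↑(φ (((2 : ℝ) ^ j)⁻¹ • ξ)) ^ 2 * ↑(θ (((2 : ℝ) ^ j)⁻¹ • ξ)) : ℂ) * hexp
  rw [hscale, fourierInv_comp_smul (fun η => ((φ η ^ 2 * θ η : ℝ) : ℂ))
    (show (0 : ℝ) < 2 ^ j by positivity), finrank_euclideanSpace_fin, smul_zero,
    Complex.ofReal_mul]
  congr 1
  rw [Real.fourierInv_eq]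
  simp only [inner_zero_right, AddChar.map_zero_eq_one, one_smul]
  exact integral_ofReal

theorem exponent_le_of_forall_two_le {s σ β c A : ℝ} (hc : 0 < c)
    (h : ∀ j : ℕ, 2 ≤ j → (2 : ℝ) ^ ((j : ℝ) * s) * c ≤
      A * ((2 : ℝ) ^ ((j : ℝ) * σ) * (2 : ℝ) ^ (-((j : ℝ) * β)))) : s ≤ σ - β := by
  by_contra! hlt
  have hgt : 1 < (2 : ℝ) ^ (s - σ + β) := Real.one_lt_rpow (by norm_num) (by linarith)
  obtain ⟨j, hj, hj2⟩ := (((tendsto_pow_atTop_atTop_of_one_lt hgt).eventually_gt_atTop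
    (A / c)).and (Filter.eventually_ge_atTop 2)).exists
  have h1 := h j hj2
  rw [← Real.rpow_add (by norm_num)] at h1
  rw [div_lt_iff₀ hc, ← Real.rpow_natCast, ← Real.rpow_mul (by norm_num)] at hj
  have h2 : (2 : ℝ) ^ ((j : ℝ) * s) = (2 : ℝ) ^ ((s - σ + β) * j) *
      (2 : ℝ) ^ ((j : ℝ) * σ + -(j * β)) := by
    rw [← Real.rpow_add (by norm_num)]
    congr 1
    ring
  have hP : 0 < (2 : ℝ) ^ ((j : ℝ) * σ + -(j * β)) := by positivity
  rw [h2] at h1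
  nlinarith [mul_lt_mul_of_pos_right hj hP]

end LittlewoodPaley

/-- **Necessary loss of `dα/2` derivatives for `e^{-it|D|^α}` on Zygmund spaces.**
Let `α > 0`, `α ≠ 1`, `S(t) = e^{−it|D_x|^α}`.  If for some `t₀ ≠ 0` the operator `S(t₀)`
(characterized by its action, via an explicit convolution kernel, on frequency-localized
bounded functions) is bounded from `C^σ_*(ℝ^d)` to `C^s_*(ℝ^d)`, then `s ≤ σ − dα/2`. -/
theorem dispersive_holder_loss (d : ℕ) (hd : 1 ≤ d) (α : ℝ) (hα : 0 < α) (hα1 : α ≠ 1)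
    (s σ t₀ : ℝ) (ht₀ : t₀ ≠ 0)
    (χl φ : EuclideanSpace ℝ (Fin d) → ℝ)
    (hφ : ContDiff ℝ (⊤ : ℕ∞) φ) (hφc : HasCompactSupport φ)
    (hφsupp : ∀ ξ, φ ξ ≠ 0 → 1 / 2 ≤ ‖ξ‖ ∧ ‖ξ‖ ≤ 2)
    (hχl : ContDiff ℝ (⊤ : ℕ∞) χl) (hχlc : HasCompactSupport χl)
    (hχlsupp : ∀ ξ, χl ξ ≠ 0 → ‖ξ‖ ≤ 1)
    (hpart : ∀ ξ, χl ξ + ∑' j : ℕ, dyadic d φ j ξ = 1)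
    (St : (EuclideanSpace ℝ (Fin d) → ℂ) → EuclideanSpace ℝ (Fin d) → ℂ)
    (hker : ∀ (j : ℕ) (u : EuclideanSpace ℝ (Fin d) → ℂ) (M : ℝ),
      Measurable u → (∀ x, ‖u x‖ ≤ M) →
      ∀ x, St (symbolOp d (dyadic d φ j) u) x =
        ∫ y, 𝓕⁻ (fun ξ : EuclideanSpace ℝ (Fin d) =>
          Complex.exp (-Complex.I * (t₀ : ℂ) * ((‖ξ‖ ^ α : ℝ) : ℂ)) * (dyadic d φ j ξ : ℂ)) y *
          u (x - y))
    (C : ℝ) (hC : 0 < C)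
    (hbound : ∀ u, zygNorm d χl φ s (St u) ≤ ENNReal.ofReal C * zygNorm d χl φ σ u) :
    s ≤ σ - d * α / 2 := by
  obtain ⟨ξ₀, hφξ₀⟩ := exists_ne_zero_of_partition hd hχlsupp hpart
  have hξ₀ : ξ₀ ≠ 0 := by
    rintro rfl
    have := (hφsupp 0 hφξ₀).1
    norm_num at this
  obtain ⟨θ, B, hB0, hB⟩ := exists_norm_fourierInv_focusingProfile_le ht₀ hα hα1 hφ hξ₀
  have hφθ : 0 < ∫ η, φ η ^ 2 * θ η := by
    refine Continuous.integral_pos_of_hasCompactSupport_nonneg_nonzero (x := ξ₀) ?_ ?_ ?_ ?_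
    · exact (hφ.continuous.pow 2).mul θ.continuous
    · exact θ.hasCompactSupport.mul_left
    · exact fun η => mul_nonneg (sq_nonneg _) θ.nonneg
    · exact mul_ne_zero (pow_ne_zero 2 hφξ₀) (θ.pos_of_mem_ball
        (Metric.mem_ball_self θ.rOut_pos)).ne'
  refine exponent_le_of_forall_two_le (A := C * (2 ^ (2 * |σ|) * B)) hφθ fun j hj => ?_
  set b := focusingProfile d t₀ α θ j with hb
  have hbc : Continuous b := continuous_focusingProfile hα θ.continuous j
  have hbs : HasCompactSupport b := hasCompactSupport_focusingProfile t₀ α θ.hasCompactSupport j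
  have hbi : Integrable b := hbc.integrable_of_hasCompactSupport hbs
  set v := symbolOp d (dyadic d φ j) (𝓕⁻ b) with hv
  have hv' : v = 𝓕⁻ (fun ξ => (dyadic d φ j ξ : ℂ) * b ξ) :=
    symbolOp_fourierInv (contDiff_dyadic hφ j) (hasCompactSupport_dyadic hφc j) hbi
  have hvi : Integrable (fun ξ => (dyadic d φ j ξ : ℂ) * b ξ) :=
    Continuous.integrable_of_hasCompactSupport
      ((Complex.continuous_ofReal.comp (contDiff_dyadic hφ j).continuous).mul hbc) hbs.mul_left
  have hSt : St v = 𝓕⁻ (fun ξ =>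
      (Complex.exp (-Complex.I * (t₀ : ℂ) * ((‖ξ‖ ^ α : ℝ) : ℂ)) * (dyadic d φ j ξ : ℂ)) *
        b ξ) := by
    funext x
    rw [hv, hker j (𝓕⁻ b) _ (continuous_fourierInv hbi).measurable (norm_fourierInv_le b) x]
    exact integral_fourierInv_mul_fourierInv_sub (contDiff_propagator_dyadic t₀ α hφ hφsupp j)
      (((hasCompactSupport_dyadic hφc j).comp_left (g := fun t : ℝ => (t : ℂ))
        Complex.ofReal_zero).mul_left) hbi x
  have hSti : Integrable (fun ξ : EuclideanSpace ℝ (Fin d) =>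
      (Complex.exp (-Complex.I * (t₀ : ℂ) * ((‖ξ‖ ^ α : ℝ) : ℂ)) * (dyadic d φ j ξ : ℂ)) *
        b ξ) :=
    Continuous.integrable_of_hasCompactSupport
      ((contDiff_propagator_dyadic t₀ α hφ hφsupp j).continuous.mul hbc) hbs.mul_left
  have hlow : symbolOp d χl v = 0 := by
    rw [hv', symbolOp_fourierInv hχl hχlc hvi]
    have h0 : (fun ξ => (χl ξ : ℂ) * ((dyadic d φ j ξ : ℂ) * b ξ)) = fun _ => 0 := by
      funext ξ
      by_cases h1 : χl ξ = 0
      · simp [h1]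
      · by_cases h2 : dyadic d φ j ξ = 0
        · simp [h2]
        · have e1 := hχlsupp ξ h1
          have e2 := (dyadic_ne_zero_bounds hφsupp h2).1
          have e3 : (2 : ℝ) ^ 2 ≤ 2 ^ j := pow_le_pow_right₀ (by norm_num) hj
          linarith
    funext x
    rw [h0]
    simp [Real.fourierInv_eq]
  have hpiece : ∀ k, symbolOp d (dyadic d φ k) v =
      𝓕⁻ (fun ξ => (dyadic d φ k ξ : ℂ) * ((dyadic d φ j ξ : ℂ) * b ξ)) := fun k => by
    rw [hv', symbolOp_fourierInv (contDiff_dyadic hφ k) (hasCompactSupport_dyadic hφc k) hvi]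
  have hfar : ∀ k, j + 2 < k ∨ k + 2 < j → symbolOp d (dyadic d φ k) v = 0 := by
    intro k hk
    have h0 : (fun ξ => (dyadic d φ k ξ : ℂ) * ((dyadic d φ j ξ : ℂ) * b ξ)) = fun _ => 0 := by
      funext ξ
      rw [← mul_assoc, ← Complex.ofReal_mul, dyadic_mul_dyadic_eq_zero hφsupp hk]
      simp
    funext x
    rw [hpiece, h0]
    simp [Real.fourierInv_eq]
  have hupper := zygNorm_le_of_localized σ hlow hfar fun k h1 h2 x => by
    rw [hpiece]
    exact hB j k h1 h2 x
  have hlower := le_zygNorm χl φ s (St v) j 0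
  rw [hSt, symbolOp_fourierInv (contDiff_dyadic hφ j) (hasCompactSupport_dyadic hφc j) hSti,
    hb, fourierInv_refocused, Complex.norm_real,
    Real.norm_of_nonneg (mul_nonneg (by positivity) hφθ.le), ← hb, ← hSt] at hlower
  have hchain := hlower.trans ((hbound v).trans (mul_le_mul_right hupper _))
  rw [← ENNReal.ofReal_mul hC.le, ENNReal.ofReal_le_ofReal_iff (by positivity)] at hchain
  have hμd : ((2 : ℝ) ^ (-(j * α / 2))) ^ d = (2 : ℝ) ^ (-((j : ℝ) * (d * α / 2))) := by
    rw [← Real.rpow_natCast, ← Real.rpow_mul (by norm_num)]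
    congr 1
    ring
  rw [hμd] at hchain
  refine le_of_mul_le_mul_left ?_ (by positivity : (0 : ℝ) < ((2 : ℝ) ^ j) ^ d)
  linarith [hchain]
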